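/- Let (X,d) be a finite ultrametric space with |X| ≥ 2. If X ∈ ℜ, then every subset Y ⊆ X with |Y| ≥ 2, equipped with the restricted metric, also belongs to ℜ. -/

import Mathlib

/-- Membership in the class `ℜ`: every surjective self-isometry of `X` has at
least `|X| - 2` fixed points. -/
def maxRigid (X : Type*) [MetricSpace X] : Prop :=
  ∀ g : X → X, Function.Surjective g → (∀ x y : X, dist (g x) (g y) = dist x y) →
    Nat.card X - 2 ≤ {x : X | g x = x}.ncard

/-- Two distinct points are twins when every other point is equidistant from both. -/
def AreTwins {X : Type*} [MetricSpace X] (x y : X) : Prop :=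
  x ≠ y ∧ ∀ z, z ≠ x → z ≠ y → dist x z = dist y z

/-- No three distinct points are pairwise equidistant. -/
def NoEquilateral (X : Type*) [MetricSpace X] : Prop :=
  ∀ a b c : X, a ≠ b → dist a b = dist b c → dist a b = dist a c → False

/-- No two pairs of distinct points have both diameters smaller than their mutual distance. -/
def NoSeparatedPairs (X : Type*) [MetricSpace X] : Prop :=
  ∀ a b c d : X, a ≠ b → c ≠ d → dist a b < dist a c → dist c d < dist a c → False

lemma le_or_le_of_ultrametric {X : Type*} [MetricSpace X] [IsUltrametricDist X] (x y z : X) :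
    dist x z ≤ dist x y ∨ dist x z ≤ dist y z :=
  le_max_iff.mp (dist_triangle_max x y z)

open scoped Classical in
lemma AreTwins.dist_swap {X : Type*} [MetricSpace X] {x y : X} (h : AreTwins x y) (p q : X) :
    dist (Equiv.swap x y p) (Equiv.swap x y q) = dist p q := by
  obtain ⟨_, h⟩ := h
  have hs : ∀ a b : X, dist a b = dist b a := dist_comm
  have h0 : ∀ a : X, dist a a = 0 := dist_self
  simp only [Equiv.swap_apply_def]
  grind

lemma exists_areTwins {X : Type*} [MetricSpace X] [IsUltrametricDist X] [Finite X] {p q : X}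
    (hpq : p ≠ q) : ∃ u v : X, AreTwins u v ∧ dist p u ≤ dist p q ∧ dist p v ≤ dist p q := by
  let S : Set (X × X) := {w | w.1 ≠ w.2 ∧ dist p w.1 ≤ dist p q ∧ dist p w.2 ≤ dist p q}
  obtain ⟨⟨u, v⟩, ⟨huv, hu, hv⟩, hmin⟩ := Set.exists_min_image S (fun w => dist w.1 w.2)
    (Set.toFinite S) ⟨(p, q), hpq, by simp, le_rfl⟩
  have key : ∀ a b z : X, dist p a ≤ dist p q → dist p b ≤ dist p q →
      dist a b = dist u v → z ≠ a → dist u v ≤ dist a z := by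
    intro a b z ha hb hab hz
    by_contra! hlt
    have hpb : dist a b ≤ dist p q := by
      have h1 := le_or_le_of_ultrametric a p b
      rw [dist_comm a p] at h1
      grind
    have hpz : dist p z ≤ dist p q := by
      have := le_or_le_of_ultrametric p a z
      grind
    have h2 := hmin (a, z) ⟨hz.symm, ha, hpz⟩
    exact absurd h2 (not_le.mpr hlt)
  refine ⟨u, v, ⟨huv, fun z hzu hzv => ?_⟩, hu, hv⟩
  have h1 := key u v z hu hv rfl hzu
  have h2 := key v u z hv hu (dist_comm v u) hzv
  have h3 := le_or_le_of_ultrametric u v z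
  have h4 := le_or_le_of_ultrametric v u z
  rw [dist_comm v u] at h4
  grind

lemma maxRigid.not_three_moved {X : Type*} [MetricSpace X] [Finite X] (hX : maxRigid X)
    (g : Equiv.Perm X) (hg : ∀ x y, dist (g x) (g y) = dist x y) {a b c : X}
    (hab : a ≠ b) (hac : a ≠ c) (hbc : b ≠ c) (ha : g a ≠ a) (hb : g b ≠ b) (hc : g c ≠ c) :
    False := by
  have h1 := hX g g.surjective hg
  have h2 := Set.ncard_add_ncard_compl {x : X | g x = x}
  have h3 : ({a, b, c} : Set X).ncard ≤ {x : X | g x = x}ᶜ.ncard := by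
    refine Set.ncard_le_ncard ?_ (Set.toFinite _)
    rintro x (rfl | rfl | rfl) <;> assumption
  rw [Set.ncard_eq_three.mpr ⟨a, b, c, hab, hac, hbc, rfl⟩] at h3
  omega

open scoped Classical in
lemma maxRigid.not_disjoint_areTwins {X : Type*} [MetricSpace X] [Finite X] (hX : maxRigid X)
    {a b c d : X} (h : AreTwins a b) (h' : AreTwins c d) (hac : a ≠ c) (had : a ≠ d)
    (hbc : b ≠ c) (hbd : b ≠ d) : False := by
  have hab := h.1
  have hcd := h'.1
  refine hX.not_three_moved (Equiv.swap a b * Equiv.swap c d)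
    (fun x y => by simp [h.dist_swap, h'.dist_swap]) hab hac hbc ?_ ?_ ?_ <;>
  · simp only [Equiv.Perm.mul_apply, Equiv.swap_apply_def]
    grind

open scoped Classical in
lemma maxRigid.not_common_areTwins {X : Type*} [MetricSpace X] [Finite X] (hX : maxRigid X)
    {a b c : X} (h : AreTwins a b) (h' : AreTwins a c) (hbc : b ≠ c) : False := by
  have hab := h.1
  have hac := h'.1
  refine hX.not_three_moved (Equiv.swap a b * Equiv.swap a c)
    (fun x y => by simp [h.dist_swap, h'.dist_swap]) hab hac hbc ?_ ?_ ?_ <;>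
  · simp only [Equiv.Perm.mul_apply, Equiv.swap_apply_def]
    grind

lemma ne_of_dist_lt {X : Type*} [MetricSpace X] [IsUltrametricDist X] {a c u v : X} {r : ℝ}
    (hac : r ≤ dist a c) (hu : dist a u < r) (hv : dist c v < r) : u ≠ v := by
  rintro rfl
  have := le_or_le_of_ultrametric a u c
  rw [dist_comm u c] at this
  grind

lemma maxRigid.noSeparatedPairs {X : Type*} [MetricSpace X] [IsUltrametricDist X] [Finite X]
    (hX : maxRigid X) : NoSeparatedPairs X := by
  intro a b c d hab hcd h1 h2
  obtain ⟨u, v, huv, hu, hv⟩ := exists_areTwins hab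
  obtain ⟨s, t, hst, hs, ht⟩ := exists_areTwins hcd
  have hne : ∀ x y, dist a x ≤ dist a b → dist c y ≤ dist c d → x ≠ y := fun x y hx hy =>
    ne_of_dist_lt le_rfl (hx.trans_lt h1) (hy.trans_lt h2)
  exact hX.not_disjoint_areTwins huv hst (hne _ _ hu hs) (hne _ _ hu ht) (hne _ _ hv hs)
    (hne _ _ hv ht)

lemma areTwins_of_isolated {X : Type*} [MetricSpace X] [IsUltrametricDist X] {a b : X}
    (hab : a ≠ b) (ha : ∀ z, z ≠ a → dist a b ≤ dist a z)
    (hb : ∀ z, z ≠ b → dist a b ≤ dist b z) : AreTwins a b := by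
  refine ⟨hab, fun z hza hzb => ?_⟩
  have h1 := ha z hza
  have h2 := hb z hzb
  have h3 := le_or_le_of_ultrametric a b z
  have h4 := le_or_le_of_ultrametric b a z
  rw [dist_comm b a] at h4
  grind

lemma maxRigid.noEquilateral {X : Type*} [MetricSpace X] [IsUltrametricDist X] [Finite X]
    (hX : maxRigid X) : NoEquilateral X := by
  intro a b c hab hbc hac
  obtain ⟨r, hr⟩ : ∃ r, r = dist a b := ⟨_, rfl⟩
  let I : X → Prop := fun p => ∀ z, z ≠ p → r ≤ dist p z
  have hpos : 0 < r := hr ▸ dist_pos.mpr hab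
  have not_two : ∀ p q, dist p q = r → I p ∨ I q := by
    intro p q hpq
    by_contra! h
    simp only [I, not_forall, not_le] at h
    obtain ⟨⟨x, hx, hpx⟩, y, hy, hqy⟩ := h
    exact hX.noSeparatedPairs p x q y hx.symm hy.symm (hpq ▸ hpx) (hpq ▸ hqy)
  have not_pair : ∀ p q s, dist p q = r → dist p s = r → dist q s = r → I p → I q → False := by
    intro p q s hpq hps hqs hp hq
    have hpq' : p ≠ q := dist_pos.mp (hpq ▸ hpos)
    have hps' : p ≠ s := dist_pos.mp (hps ▸ hpos)
    have hqs' : q ≠ s := dist_pos.mp (hqs ▸ hpos)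
    have h1 : AreTwins p q := areTwins_of_isolated hpq' (hpq ▸ hp) (hpq ▸ hq)
    by_cases hs : I s
    · exact hX.not_common_areTwins h1 (areTwins_of_isolated hps' (hps ▸ hp) (hps ▸ hs)) hqs'
    · simp only [I, not_forall, not_le] at hs
      obtain ⟨z, hz, hsz⟩ := hs
      obtain ⟨u, v, huv, hu, hv⟩ := exists_areTwins hz.symm
      have hne : ∀ x w, dist x s = r → dist s w ≤ dist s z → x ≠ w := fun x w hx hw =>
        ne_of_dist_lt hx.ge (by simpa using hpos) (hw.trans_lt hsz)
      exact hX.not_disjoint_areTwins h1 huv (hne _ _ hps hu) (hne _ _ hps hv) (hne _ _ hqs hu)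
        (hne _ _ hqs hv)
  have hab' : dist a b = r := hr.symm
  have hbc' : dist b c = r := by rw [← hbc, hr]
  have hac' : dist a c = r := by rw [← hac, hr]
  have hba' := (dist_comm b a).trans hab'
  have hcb' := (dist_comm c b).trans hbc'
  have hca' := (dist_comm c a).trans hac'
  have h1 := not_two a b hab'
  have h2 := not_two b c hbc'
  have h3 := not_two a c hac'
  have h4 := not_pair a b c hab' hac' hbc'
  have h5 := not_pair b c a hbc' hba' hca'
  have h6 := not_pair a c b hac' hab' hcb'
  tauto

lemma involutive_of_noEquilateral {X : Type*} [MetricSpace X] [IsUltrametricDist X]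
    (h3 : NoEquilateral X) (h4 : NoSeparatedPairs X) {g : X → X}
    (hg : ∀ x y, dist (g x) (g y) = dist x y) (x : X) : g (g x) = x := by
  by_contra hne
  have e1 := hg x (g x)
  have e2 := hg x (g (g x))
  have hx : x ≠ g x := fun h => hne (by rw [← h, ← h])
  have hgx : g x ≠ g (g (g x)) := by
    rw [← dist_pos, e2, dist_pos]
    exact Ne.symm hne
  have hlt : dist x (g (g x)) < dist x (g x) := by
    have h := le_or_le_of_ultrametric x (g x) (g (g x))
    have h' : dist x (g x) ≠ dist x (g (g x)) := fun h' => h3 _ _ _ hx e1.symm h'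
    grind
  exact h4 x (g (g x)) (g x) (g (g (g x))) (Ne.symm hne) hgx hlt (e2 ▸ hlt)

lemma moved_eq_or_eq {X : Type*} [MetricSpace X] [IsUltrametricDist X]
    (h3 : NoEquilateral X) (h4 : NoSeparatedPairs X) {g : X → X}
    (hg : ∀ x y, dist (g x) (g y) = dist x y) {x y : X} (hx : g x ≠ x) (hy : g y ≠ y) :
    y = x ∨ y = g x := by
  have hinv := involutive_of_noEquilateral h3 h4 hg
  by_contra! hne
  obtain ⟨hyx, hygx⟩ := hne
  have hgy : g y ≠ x := fun h => hygx (by rw [← h, hinv])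
  have hgg : g x ≠ g y := fun h => hyx (by rw [← hinv y, ← h, hinv])
  have e1 : dist (g x) (g y) = dist x y := hg x y
  have e2 : dist (g x) y = dist x (g y) := by rw [← hg (g x) y, hinv]
  have t1 := le_or_le_of_ultrametric x y (g x)
  have t2 := le_or_le_of_ultrametric x (g x) y
  have t3 := le_or_le_of_ultrametric y x (g x)
  have t4 := le_or_le_of_ultrametric y x (g y)
  have s1 := h3 x (g x) y hx.symm
  have s2 := h3 y (g y) x hy.symm
  have f1 := h4 x (g x) y (g y) hx.symm hy.symm
  have f2 := h4 x y (g x) (g y) hyx.symm hgg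
  have f3 := h4 x (g y) (g x) y hgy.symm (Ne.symm hygx)
  have hs : ∀ a b : X, dist a b = dist b a := dist_comm
  rw [hs y (g x)] at t1 t3
  rw [hs y x] at t3 t4 s2
  rw [hs (g y) x] at s2
  rw [e1] at f2
  rw [e2] at s1 t1 t2 t3 f3
  rcases lt_trichotomy (dist x y) (dist x (g y)) with h | h | h <;> grind

lemma maxRigid_of_noEquilateral {X : Type*} [MetricSpace X] [IsUltrametricDist X] [Finite X]
    (h3 : NoEquilateral X) (h4 : NoSeparatedPairs X) : maxRigid X := by
  intro g _ hg
  have h := Set.ncard_add_ncard_compl {x : X | g x = x}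
  suffices {x : X | g x = x}ᶜ.ncard ≤ 2 by omega
  rcases Set.eq_empty_or_nonempty {x : X | g x = x}ᶜ with he | ⟨x, hx⟩
  · simp [he]
  · refine (Set.ncard_le_ncard (t := {x, g x}) (fun y hy => ?_) (Set.toFinite _)).trans
      (Set.ncard_pair (Ne.symm hx)).le
    exact moved_eq_or_eq h3 h4 hg hx hy

/-- If a finite ultrametric space `X` with `|X| ≥ 2` belongs
to `ℜ`, then every subspace `Y ⊆ X` with `|Y| ≥ 2` also belongs to `ℜ`. -/
theorem stmt11 (X : Type*) [MetricSpace X] [IsUltrametricDist X] [Fintype X]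
    (hcard : 2 ≤ Fintype.card X) (hX : maxRigid X)
    (Y : Set X) (hY : 2 ≤ Y.ncard) :
    maxRigid Y := by
  have : IsUltrametricDist Y := ⟨fun x y z => dist_triangle_max (x : X) y z⟩
  refine maxRigid_of_noEquilateral ?_ ?_
  · exact fun a b c hab => hX.noEquilateral a b c (Subtype.coe_injective.ne hab)
  · exact fun a b c d hab hcd => hX.noSeparatedPairs a b c d (Subtype.coe_injective.ne hab)
      (Subtype.coe_injective.ne hcd)
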